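/- arXiv:2410.11292 — 4 statements merged into one kernel-verified Lean document; each statement's English description precedes it below -/
import Mathlib

section
/- Let (S,φ) be an exchangeable interaction and (X,E) a finite connected symmetric digraph. For any configuration η ∈ S^X and any x,y ∈ X, the configurations η and η^{x,y} (obtained from η by swapping the values at x and y) lie in the same connected component of (S^X, Φ_E). -/
/-- A conserved quantity of the interaction `(S, φ)`. -/
def IsConserved {S : Type} (φ : S × S → S × S → Prop) (ξ : S → ℝ) : Prop :=
  ∀ s t s' t' : S, φ (s, t) (s', t') → ξ s + ξ t = ξ s' + ξ t'

/-- The relation `Φ_E` on the configuration space `S^X`. -/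
def PhiE {S X : Type} (φ : S × S → S × S → Prop) (E : X → X → Prop)
    (η η' : X → S) : Prop :=
  ∃ x y : X, E x y ∧ φ (η x, η y) (η' x, η' y) ∧ ∀ z : X, z ≠ x → z ≠ y → η z = η' z

/-- Connectivity of the digraph `(X, E)`. -/
def IsConnectedDigraph {X : Type} (E : X → X → Prop) : Prop :=
  Nonempty X ∧ ∀ x y : X, Relation.ReflTransGen E x y

/-- The interaction `(S, φ)` is exchangeable: `(s, t)` and `(t, s)` lie in the same
connected component of the digraph `(S × S, φ)`. -/
def Exchangeable {S : Type} (φ : S × S → S × S → Prop) : Prop :=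
  ∀ s t : S, Relation.EqvGen φ (s, t) (t, s)

/-- The configuration `η^{x,y}` obtained from `η` by swapping the values at `x` and `y`. -/
def swapConfig {S X : Type} [DecidableEq X] (η : X → S) (x y : X) : X → S := fun z =>
  if z = x then η y else if z = y then η x else η z

theorem PhiE.update_update {S X : Type} [DecidableEq X] {φ : S × S → S × S → Prop}
    {E : X → X → Prop} (η : X → S) {x y : X} (hE : E x y) (hxy : x ≠ y) {p q : S × S}
    (h : φ p q) :
    PhiE φ E (Function.update (Function.update η x p.1) y p.2)
      (Function.update (Function.update η x q.1) y q.2) := by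
  refine ⟨x, y, hE, by simpa [hxy] using h, fun z hzx hzy => ?_⟩
  simp [hzx, hzy]

theorem eqvGen_update_update {S X : Type} [DecidableEq X] {φ : S × S → S × S → Prop}
    {E : X → X → Prop} (η : X → S) {x y : X} (hE : E x y) (hxy : x ≠ y) {p q : S × S}
    (h : Relation.EqvGen φ p q) :
    Relation.EqvGen (PhiE φ E) (Function.update (Function.update η x p.1) y p.2)
      (Function.update (Function.update η x q.1) y q.2) := by
  induction h with
  | rel p q h => exact .rel _ _ (PhiE.update_update η hE hxy h)
  | refl p => exact .refl _
  | symm p q _ ih => exact .symm _ _ ih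
  | trans p q r _ _ ih₁ ih₂ => exact .trans _ _ _ ih₁ ih₂

theorem swapConfig_self {S X : Type} [DecidableEq X] (η : X → S) (x : X) :
    swapConfig η x x = η := by
  ext z
  simp +contextual [swapConfig]

theorem swapConfig_eq_update_update {S X : Type} [DecidableEq X] (η : X → S) {x y : X}
    (hxy : x ≠ y) :
    swapConfig η x y = Function.update (Function.update η x (η y)) y (η x) := by
  ext z
  grind [swapConfig, Function.update_apply]

/-- Conjugating the transposition `(x b)` by `(b c)` gives `(x c)`. -/
theorem swapConfig_conj {S X : Type} [DecidableEq X] (η : X → S) {x b c : X}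
    (hxb : x ≠ b) (hxc : x ≠ c) :
    swapConfig (swapConfig (swapConfig η b c) x b) b c = swapConfig η x c := by
  ext z
  grind [swapConfig]

theorem eqvGen_swapConfig_of_adj {S X : Type} [DecidableEq X] {φ : S × S → S × S → Prop}
    (hex : Exchangeable φ) {E : X → X → Prop} (η : X → S) {x y : X} (hE : E x y) :
    Relation.EqvGen (PhiE φ E) η (swapConfig η x y) := by
  by_cases hxy : x = y
  · subst hxy
    rw [swapConfig_self]
    exact .refl _
  · simpa [swapConfig_eq_update_update η hxy] using
      eqvGen_update_update η hE hxy (hex (η x) (η y))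

/-- For an exchangeable interaction `(S, φ)` and a finite connected symmetric digraph
`(X, E)`, any configuration `η` and its swap `η^{x,y}` lie in the same connected component
of `(S^X, Φ_E)`. -/
theorem swap_in_same_component {S X : Type} [Fintype S] [Fintype X] [DecidableEq X]
    (φ : S × S → S × S → Prop) (hsymm : Symmetric φ) (hex : Exchangeable φ)
    (E : X → X → Prop) (hEsymm : Symmetric E) (hEirr : Irreflexive E)
    (hconn : IsConnectedDigraph E) (η : X → S) (x y : X) :
    Relation.EqvGen (PhiE φ E) η (swapConfig η x y) := by
  induction hconn.2 x y generalizing η with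
  | refl =>
    rw [swapConfig_self]
    exact .refl _
  | @tail b c _ hbc ih =>
    by_cases hxb : x = b
    · exact hxb ▸ eqvGen_swapConfig_of_adj hex η (hxb ▸ hbc)
    by_cases hxc : x = c
    · rw [← hxc, swapConfig_self]
      exact .refl _
    rw [← swapConfig_conj η hxb hxc]
    exact .trans _ _ _ (eqvGen_swapConfig_of_adj hex η hbc)
      (.trans _ _ _ (ih _) (eqvGen_swapConfig_of_adj hex _ hbc))
end

section
/- Let S = {1,…,n}, let (S,φ) be an exchangeable interaction, and let (X,E) be a finite connected symmetric digraph. If two configurations η, η' ∈ S^X satisfy η_M = η'_M in the semigroup M(S,φ), then η and η' lie in the same connected component of (S^X, Φ_E). -/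
/-- The defining relations `a_i a_j = a_k a_l` for `((i,j),(k,l)) ∈ φ` of the semigroup
`M(S, φ)`. -/
def interactionRel {n : ℕ} (φ : (Fin n × Fin n) → (Fin n × Fin n) → Prop) :
    FreeSemigroup (Fin n) → FreeSemigroup (Fin n) → Prop := fun w w' =>
  ∃ i j k l : Fin n, φ (i, j) (k, l) ∧
    w = FreeSemigroup.of i * FreeSemigroup.of j ∧
    w' = FreeSemigroup.of k * FreeSemigroup.of l

/-- The congruence on the free semigroup generated by the defining relations. -/
def interactionCon {n : ℕ} (φ : (Fin n × Fin n) → (Fin n × Fin n) → Prop) :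
    Con (FreeSemigroup (Fin n)) :=
  conGen (interactionRel φ)

/-- The semigroup `M(S, φ)` associated to the interaction `(S, φ)`, i.e. the quotient of the
free semigroup on `a_1, …, a_n` by the congruence generated by the relations
`a_i a_j = a_k a_l` for `((i,j),(k,l)) ∈ φ`. -/
abbrev InteractionSemigroup {n : ℕ} (φ : (Fin n × Fin n) → (Fin n × Fin n) → Prop) :=
  (interactionCon φ).Quotient

/-- The generator `a_i` of `M(S, φ)`. -/
def genM {n : ℕ} (φ : (Fin n × Fin n) → (Fin n × Fin n) → Prop) (i : Fin n) :
    InteractionSemigroup φ :=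
  ((FreeSemigroup.of i : FreeSemigroup (Fin n)) : InteractionSemigroup φ)

/-- The sorted list `1^{p_1} … n^{p_n}` of values of a configuration `η : X → Fin n`,
where `p_i = #{x ∈ X ∣ η x = i}`. -/
def configList {n : ℕ} {X : Type} [Fintype X] (η : X → Fin n) : List (Fin n) :=
  (List.finRange n).flatMap fun i =>
    List.replicate (Finset.univ.filter fun x => η x = i).card i

/-- Product of a nonempty list in a semigroup (with a default value for `[]`). -/
def listProd' {α : Type} [Semigroup α] (dflt : α) (l : List α) : α :=
  l.tail.foldl (· * ·) (l.headD dflt)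

/-- The element `η_M = a_1^{p_1} ⋯ a_n^{p_n}` of `M(S, φ)` associated to a configuration
`η : X → Fin n`, where `p_i = #{x ∈ X ∣ η x = i}`.  (The default element is never used,
as the list of values of `η` is nonempty.) -/
noncomputable def etaM {n : ℕ} (φ : (Fin n × Fin n) → (Fin n × Fin n) → Prop)
    {X : Type} [Fintype X] [Nonempty X] (η : X → Fin n) : InteractionSemigroup φ :=
  listProd' (genM φ (η (Classical.arbitrary X))) ((configList η).map (genM φ))

open Relation

section Configurations

variable {S X : Type} {φ : S × S → S × S → Prop} {E : X → X → Prop}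

/-- Moves along one edge: the values at the ends of an edge may be replaced by any pair in the
same connected component of `(S × S, φ)`. -/
theorem eqvGen_PhiE_update [DecidableEq X] {x y : X} (hxy : E x y) (hne : x ≠ y) (η : X → S)
    {p q : S × S} (hpq : EqvGen φ p q) :
    EqvGen (PhiE φ E) (Function.update (Function.update η x p.1) y p.2)
      (Function.update (Function.update η x q.1) y q.2) := by
  induction hpq with
  | rel p q h =>
    refine .rel _ _ ⟨x, y, hxy, ?_, fun z hzx hzy => ?_⟩
    · simpa [Function.update_of_ne hne] using h
    · simp [hzx, hzy]
  | refl p => exact .refl _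
  | symm p q _ ih => exact ih.symm
  | trans p q r _ _ ih₁ ih₂ => exact ih₁.trans _ _ _ ih₂

theorem eqvGen_PhiE_comp_swap [DecidableEq X] (hex : Exchangeable φ) {x y : X} (hxy : E x y)
    (hne : x ≠ y) (η : X → S) : EqvGen (PhiE φ E) η (η ∘ Equiv.swap x y) := by
  have h := eqvGen_PhiE_update hxy hne η (hex (η x) (η y))
  convert h using 1
  · simp
  · funext z
    simp only [Function.comp_apply, Equiv.swap_apply_def, Function.update_apply]
    split_ifs <;> simp_all

/-- Permuting the sites of a configuration does not change its connected component. -/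
theorem eqvGen_PhiE_comp_perm [Finite X] (hex : Exchangeable φ) (hEirr : Irreflexive E)
    (hconn : IsConnectedDigraph E) (σ : Equiv.Perm X) (η : X → S) :
    EqvGen (PhiE φ E) η (η ∘ σ) := by
  classical
  let H : Submonoid (Equiv.Perm X) :=
    { carrier := {σ | ∀ η : X → S, EqvGen (PhiE φ E) η (η ∘ σ)}
      one_mem' := fun η => .refl _
      mul_mem' := fun {σ τ} hσ hτ η => (hσ η).trans _ _ _ (hτ (η ∘ σ)) }
  have hswap : ∀ x y : X, Equiv.swap x y ∈ H := by
    intro x y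
    induction hconn.2 x y with
    | refl => rw [Equiv.swap_self]; exact H.one_mem
    | @tail b c _ hbc ih =>
      refine SubmonoidClass.swap_mem_trans H ih fun η => ?_
      exact eqvGen_PhiE_comp_swap hex hbc (fun h => hEirr b (h ▸ hbc)) η
  have hσ : σ ∈ H := by
    induction σ using Equiv.Perm.swap_induction_on with
    | one => exact H.one_mem
    | swap_mul f x y _ ih => exact H.mul_mem (hswap x y) ih
  exact hσ η

theorem exists_perm_of_map_univ_eq [Fintype X] {η η' : X → S}
    (h : Finset.univ.val.map η = Finset.univ.val.map η') : ∃ σ : Equiv.Perm X, η = η' ∘ σ := by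
  classical
  have hcard (s : S) : Fintype.card {x // η x = s} = Fintype.card {x // η' x = s} := by
    have hs := congrArg (Multiset.count s) h
    simpa [Multiset.count_map, Fintype.card_subtype, Finset.card_def, eq_comm] using hs
  let e (s : S) : {x // η x = s} ≃ {x // η' x = s} := Fintype.equivOfCardEq (hcard s)
  exact ⟨Equiv.ofFiberEquiv e, funext fun x => (Equiv.ofFiberEquiv_map e x).symm⟩

/-- Configurations with the same multiset of values lie in the same connected component. -/
theorem eqvGen_PhiE_of_map_eq [Fintype X] (hex : Exchangeable φ) (hEirr : Irreflexive E)
    (hconn : IsConnectedDigraph E) {η η' : X → S}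
    (h : Finset.univ.val.map η = Finset.univ.val.map η') : EqvGen (PhiE φ E) η η' := by
  obtain ⟨σ, rfl⟩ := exists_perm_of_map_univ_eq h
  exact (eqvGen_PhiE_comp_perm hex hEirr hconn σ η').symm

theorem exists_map_univ_eq [Fintype X] (m : Multiset S) (hm : m.card = Fintype.card X) :
    ∃ η : X → S, Finset.univ.val.map η = m := by
  induction m using Quotient.inductionOn with
  | h l =>
    have hl : l.length = Fintype.card X := by simpa using hm
    let e : X ≃ Fin l.length := (Fintype.equivFin X).trans (finCongr hl.symm)
    refine ⟨l.get ∘ e, ?_⟩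
    rw [← Multiset.map_map, Multiset.map_univ_val_equiv, Fin.univ_val_map, List.ofFn_get]
    rfl

theorem map_univ_eq_cons [Fintype X] [DecidableEq X] (η : X → S) (a : X) :
    Finset.univ.val.map η = η a ::ₘ (Finset.univ.erase a).val.map η := by
  rw [← Multiset.map_cons, Finset.erase_val, Multiset.cons_erase (Finset.mem_univ_val a)]

theorem map_univ_eq_cons_cons [Fintype X] [DecidableEq X] (η : X → S) {a b : X} (hab : a ≠ b) :
    Finset.univ.val.map η = η a ::ₘ η b ::ₘ ((Finset.univ.erase a).erase b).val.map η := by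
  have hb : b ∈ (Finset.univ.erase a).val := by
    rw [Finset.mem_val]
    simp [hab.symm]
  rw [map_univ_eq_cons η a, Finset.erase_val (Finset.univ.erase a) b, ← Multiset.map_cons η b,
    Multiset.cons_erase hb]

theorem map_univ_comp_perm [Fintype X] (η : X → S) (σ : Equiv.Perm X) :
    Finset.univ.val.map (η ∘ σ) = Finset.univ.val.map η := by
  rw [← Multiset.map_map, Multiset.map_univ_val_equiv]

theorem exists_map_univ_eq_of_cons_cons [Fintype X] (η : X → S) {a b : X} (hab : a ≠ b)
    {i j : S} {m : Multiset S} (h : Finset.univ.val.map η = i ::ₘ j ::ₘ m) :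
    ∃ ζ : X → S, Finset.univ.val.map ζ = Finset.univ.val.map η ∧ ζ a = i ∧ ζ b = j := by
  classical
  obtain ⟨x, -, hx⟩ := Multiset.mem_map.1 (h ▸ Multiset.mem_cons_self i _)
  let ξ : X → S := η ∘ Equiv.swap a x
  have hξa : ξ a = i := by simp [ξ, hx]
  have hξ : Finset.univ.val.map ξ = Finset.univ.val.map η := map_univ_comp_perm _ _
  have hj : j ::ₘ m = (Finset.univ.erase a).val.map ξ := by
    rw [map_univ_eq_cons ξ a, hξa, h] at hξ
    exact ((Multiset.cons_inj_right i).1 hξ).symm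
  obtain ⟨y, hy, hyj⟩ := Multiset.mem_map.1 (hj ▸ Multiset.mem_cons_self j m)
  have hya : y ≠ a := Finset.ne_of_mem_erase hy
  refine ⟨ξ ∘ Equiv.swap b y, (map_univ_comp_perm _ _).trans hξ, ?_, by simp [hyj]⟩
  rw [Function.comp_apply, Equiv.swap_apply_of_ne_of_ne hab hya.symm, hξa]

/-- Configurations whose multisets of values differ by one elementary move lie in the same
connected component. -/
theorem eqvGen_PhiE_of_cons_cons [Fintype X] (hex : Exchangeable φ) (hEirr : Irreflexive E)
    (hconn : IsConnectedDigraph E) {i j k l : S} (hφ : φ (i, j) (k, l)) {m : Multiset S}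
    {η η' : X → S} (h : Finset.univ.val.map η = i ::ₘ j ::ₘ m)
    (h' : Finset.univ.val.map η' = k ::ₘ l ::ₘ m) : EqvGen (PhiE φ E) η η' := by
  classical
  obtain ⟨a, b, hE⟩ : ∃ a b, E a b := by
    have hcard : 1 < Fintype.card X := by
      have := congrArg Multiset.card h
      simp at this
      omega
    obtain ⟨x, y, hxy⟩ := Fintype.one_lt_card_iff.1 hcard
    rcases (hconn.2 x y).cases_head with h | ⟨c, hc, -⟩
    exacts [absurd h hxy, ⟨x, c, hc⟩]
  have hab : a ≠ b := fun h => hEirr a (h ▸ hE)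
  obtain ⟨ζ, hζ, hζa, hζb⟩ := exists_map_univ_eq_of_cons_cons η hab h
  let ζ' : X → S := Function.update (Function.update ζ a k) b l
  have hζζ' : EqvGen (PhiE φ E) ζ ζ' := by
    have := eqvGen_PhiE_update hE hab ζ (.rel _ _ hφ)
    rwa [← hζa, ← hζb, Function.update_eq_self, Function.update_eq_self] at this
  have hζ' : Finset.univ.val.map ζ' = Finset.univ.val.map η' := by
    have hm : ((Finset.univ.erase a).erase b).val.map ζ = m := by
      rw [h, map_univ_eq_cons_cons ζ hab, hζa, hζb] at hζ
      exact (Multiset.cons_inj_right j).1 ((Multiset.cons_inj_right i).1 hζ)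
    have hm' : ((Finset.univ.erase a).erase b).val.map ζ' = m := by
      rw [← hm]
      refine Multiset.map_congr rfl fun z hz => ?_
      have hz' : z ≠ b ∧ z ≠ a := by
        rw [Finset.mem_val] at hz
        simpa using hz
      simp [ζ', hz'.1, hz'.2]
    rw [map_univ_eq_cons_cons ζ' hab, hm', h']
    simp [ζ', Function.update_of_ne hab]
  exact ((eqvGen_PhiE_of_map_eq hex hEirr hconn hζ.symm).trans _ _ _ hζζ').trans _ _ _
    (eqvGen_PhiE_of_map_eq hex hEirr hconn hζ')

end Configurations

section Words

variable {S : Type}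

/-- The multiset of letters of a word. -/
def wordContent : FreeSemigroup S →ₙ* Multiplicative (Multiset S) :=
  FreeSemigroup.lift fun s => Multiplicative.ofAdd {s}

/-- Two words are related when, in every context `m`, configurations with contents `m + w` and
`m + w'` lie in the same connected component. -/
def componentCon {X : Type} [Fintype X] {φ : S × S → S × S → Prop} {E : X → X → Prop}
    (hex : Exchangeable φ) (hEirr : Irreflexive E) (hconn : IsConnectedDigraph E) :
    Con (FreeSemigroup S) where
  r w w' := (wordContent w).toAdd.card = (wordContent w').toAdd.card ∧
    ∀ (m : Multiset S) (η η' : X → S),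
      Finset.univ.val.map η = m + (wordContent w).toAdd →
      Finset.univ.val.map η' = m + (wordContent w').toAdd → EqvGen (PhiE φ E) η η'
  iseqv :=
    { refl := fun w => ⟨rfl, fun m η η' h h' =>
        eqvGen_PhiE_of_map_eq hex hEirr hconn (h.trans h'.symm)⟩
      symm := fun ⟨hc, H⟩ => ⟨hc.symm, fun m η η' h h' => (H m η' η h' h).symm⟩
      trans := fun {u v w} ⟨hc₁, H₁⟩ ⟨hc₂, H₂⟩ => ⟨hc₁.trans hc₂, fun m η η' h h' => by
        obtain ⟨ζ, hζ⟩ := exists_map_univ_eq (X := X) (m + (wordContent v).toAdd) (by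
          have := congrArg Multiset.card h
          simp only [Multiset.card_map, Multiset.card_add] at this
          rw [Multiset.card_add, ← hc₁, ← this]
          rfl)
        exact (H₁ m η ζ h hζ).trans _ _ _ (H₂ m ζ η' hζ h')⟩ }
  mul' := fun {u u' v v'} ⟨hc₁, H₁⟩ ⟨hc₂, H₂⟩ => by
    refine ⟨by simp [hc₁, hc₂], fun m η η' h h' => ?_⟩
    rw [map_mul, toAdd_mul] at h h'
    obtain ⟨ζ, hζ⟩ := exists_map_univ_eq (X := X)
      (m + ((wordContent u').toAdd + (wordContent v).toAdd)) (by
        have := congrArg Multiset.card h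
        simp only [Multiset.card_map, Multiset.card_add] at this
        rw [Multiset.card_add, Multiset.card_add, ← hc₁, ← this]
        rfl)
    refine (H₁ (m + (wordContent v).toAdd) η ζ ?_ ?_).trans _ _ _
      (H₂ (m + (wordContent u').toAdd) ζ η' ?_ ?_)
    · rw [h]; abel
    · rw [hζ]; abel
    · rw [hζ]; abel
    · rw [h']; abel

theorem add_wordContent_of_mul_of (m : Multiset S) (i j : S) :
    m + (wordContent (FreeSemigroup.of i * FreeSemigroup.of j)).toAdd = i ::ₘ j ::ₘ m := by
  rw [map_mul, toAdd_mul, add_comm, add_assoc, ← Multiset.singleton_add, ← Multiset.singleton_add]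
  rfl

theorem map_listProd' {α β : Type} [Semigroup α] [Semigroup β] (f : α →ₙ* β) (d : α)
    (l : List α) : f (listProd' d l) = listProd' (f d) (l.map f) := by
  have hfold : ∀ (l : List α) (a : α),
      f (l.foldl (· * ·) a) = (l.map f).foldl (· * ·) (f a) := by
    intro l
    induction l with
    | nil => intro a; rfl
    | cons b l ih => intro a; simp [ih]
  cases l <;> simp [listProd', hfold]

theorem listProd'_eq_prod {α : Type} [Monoid α] (d : α) {l : List α} (hl : l ≠ []) :
    listProd' d l = l.prod := by
  cases l with
  | nil => exact absurd rfl hl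
  | cons a l => rw [listProd', List.prod_eq_foldl]; simp

theorem wordContent_listProd' (d : S) {l : List S} (hl : l ≠ []) :
    (wordContent (listProd' (FreeSemigroup.of d) (l.map FreeSemigroup.of))).toAdd = l := by
  rw [map_listProd', listProd'_eq_prod _ (by simpa using hl), List.map_map]
  clear hl
  induction l with
  | nil => rfl
  | cons s l ih =>
    rw [List.map_cons, List.prod_cons, toAdd_mul, ih, ← Multiset.cons_coe,
      ← Multiset.singleton_add]
    rfl

end Words

theorem coe_configList {n : ℕ} {X : Type} [Fintype X] (η : X → Fin n) :
    (configList η : Multiset (Fin n)) = Finset.univ.val.map η := by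
  ext i
  rw [Multiset.coe_count, Multiset.count_map, configList, List.count_flatMap]
  simp only [Function.comp_def, List.count_replicate]
  rw [← Fin.sum_univ_def]
  simp only [beq_iff_eq, Finset.sum_ite_eq', Finset.mem_univ, if_true, eq_comm (a := i)]
  rfl

theorem configList_ne_nil {n : ℕ} {X : Type} [Fintype X] [Nonempty X] (η : X → Fin n) :
    configList η ≠ [] := by
  intro h
  have := congrArg Multiset.card (coe_configList η)
  simp [h, Fintype.card_ne_zero.symm] at this

/-- The word in the free semigroup representing `etaM φ η`. -/
noncomputable def configWord {n : ℕ} {X : Type} [Fintype X] [Nonempty X] (η : X → Fin n) :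
    FreeSemigroup (Fin n) :=
  listProd' (FreeSemigroup.of (η (Classical.arbitrary X))) ((configList η).map FreeSemigroup.of)

theorem wordContent_configWord {n : ℕ} {X : Type} [Fintype X] [Nonempty X] (η : X → Fin n) :
    (wordContent (configWord η)).toAdd = Finset.univ.val.map η := by
  rw [configWord, wordContent_listProd' _ (configList_ne_nil η), coe_configList]

theorem etaM_eq_coe_configWord {n : ℕ} (φ : (Fin n × Fin n) → (Fin n × Fin n) → Prop)
    {X : Type} [Fintype X] [Nonempty X] (η : X → Fin n) :
    etaM φ η = (configWord η : InteractionSemigroup φ) := by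
  let f : FreeSemigroup (Fin n) →ₙ* InteractionSemigroup φ := ⟨fun w => w, fun _ _ => rfl⟩
  refine Eq.trans ?_ (map_listProd' f _ _).symm
  rw [List.map_map]
  rfl

/-- For an exchangeable interaction `(S, φ)` and a finite connected symmetric digraph
`(X, E)`, if two configurations `η, η'` satisfy `η_M = η'_M` in `M(S, φ)`, then `η` and
`η'` lie in the same connected component of `(S^X, Φ_E)`. -/
theorem same_component_of_etaM_eq {n : ℕ} {X : Type} [Fintype X] [Nonempty X]
    (φ : (Fin n × Fin n) → (Fin n × Fin n) → Prop) (hsymm : Symmetric φ)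
    (hex : Exchangeable φ)
    (E : X → X → Prop) (hEsymm : Symmetric E) (hEirr : Irreflexive E)
    (hconn : IsConnectedDigraph E) (η η' : X → Fin n)
    (h : etaM φ η = etaM φ η') :
    Relation.EqvGen (PhiE φ E) η η' := by
  rw [etaM_eq_coe_configWord, etaM_eq_coe_configWord] at h
  have hle : interactionCon φ ≤ componentCon hex hEirr hconn := by
    refine Con.conGen_le.2 ?_
    rintro _ _ ⟨i, j, k, l, hφ, rfl, rfl⟩
    refine ⟨rfl, fun m ζ ζ' hζ hζ' => ?_⟩
    refine eqvGen_PhiE_of_cons_cons hex hEirr hconn hφ (m := m) ?_ ?_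
    · rw [hζ, add_wordContent_of_mul_of]
    · rw [hζ', add_wordContent_of_mul_of]
  refine (hle ((Con.eq _).1 h)).2 0 η η' ?_ ?_
  · rw [zero_add, wordContent_configWord]
  · rw [zero_add, wordContent_configWord]
end

section
/- Let M be a finitely generated commutative semigroup that has no identity element, is cancellative, and is power-cancellative. Then there exist d ∈ ℤ_{>0} and an injective semigroup homomorphism from M into (ℕ^d, +); equivalently, the elements of M are separated by finitely many semigroup homomorphisms of M into (ℕ, +). -/
/-- `spow a N = a ^ (N + 1)` in a semigroup, so that `spow a N` for `N : ℕ` ranges over all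
positive powers of `a`. -/
def spow {α : Type} [Semigroup α] (a : α) : ℕ → α
  | 0 => a
  | N + 1 => spow a N * a

/-- A form of Gordan's theorem over `ℤ`: if the only vanishing nonnegative combination of a finite
family of vectors is the trivial one, then some linear functional is positive on the family. -/
theorem exists_linearMap_int_pos {ι L : Type*} [AddCommGroup L] [Module.Free ℤ L]
    (s : Finset ι) (v : ι → L)
    (hv : ∀ n : ι → ℤ, (∀ i ∈ s, 0 ≤ n i) → ∑ i ∈ s, n i • v i = 0 → ∀ i ∈ s, n i = 0) :
    ∃ φ : L →ₗ[ℤ] ℤ, ∀ i ∈ s, 0 < φ (v i) := by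
  classical
  induction s using Finset.induction_on generalizing v with
  | empty => exact ⟨0, by simp⟩
  | insert k s hk ih =>
    have hv_cons (c : ℤ) (hc : 0 ≤ c) (n : ι → ℤ) (hn : ∀ i ∈ s, 0 ≤ n i)
        (h : c • v k + ∑ i ∈ s, n i • v i = 0) : c = 0 ∧ ∀ i ∈ s, n i = 0 := by
      have hne : ∀ i ∈ s, i ≠ k := fun i hi hik => hk (hik ▸ hi)
      have hsum : ∑ i ∈ s, Function.update n k c i • v i = ∑ i ∈ s, n i • v i :=
        Finset.sum_congr rfl fun i hi => by rw [Function.update_of_ne (hne i hi)]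
      have key := hv (Function.update n k c)
        (by
          intro i hi
          rcases Finset.mem_insert.1 hi with rfl | hi
          · simpa using hc
          · rw [Function.update_of_ne (hne i hi)]; exact hn i hi)
        (by rw [Finset.sum_insert hk, hsum]; simpa using h)
      refine ⟨by simpa using key k (Finset.mem_insert_self k s), fun i hi => ?_⟩
      have := key i (Finset.mem_insert_of_mem hi)
      rwa [Function.update_of_ne (hne i hi)] at this
    obtain ⟨φ, hφ⟩ := ih v fun n hn h => (hv_cons 0 le_rfl n hn (by simpa using h)).2
    obtain hpos | hnonpos := lt_or_ge 0 (φ (v k))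
    · exact ⟨φ, by simpa [hpos] using hφ⟩
    -- Replace `φ` by a functional vanishing on `v k`.
    obtain ⟨ψ, hψk, hψ⟩ : ∃ ψ : L →ₗ[ℤ] ℤ, ψ (v k) = 0 ∧ ∀ i ∈ s, 0 < ψ (v i) := by
      obtain hzero | hneg := hnonpos.eq_or_lt
      · exact ⟨φ, hzero, hφ⟩
      obtain ⟨ψ, hψ⟩ := ih (fun i => φ (v i) • v k - φ (v k) • v i) fun n hn h => by
        have h' := (hv_cons (∑ i ∈ s, n i * φ (v i))
          (Finset.sum_nonneg fun i hi => mul_nonneg (hn i hi) (hφ i hi).le)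
          (fun i => n i * -φ (v k)) (fun i hi => mul_nonneg (hn i hi) (by lia))
          (by
            rw [← h, Finset.sum_smul, ← Finset.sum_add_distrib]
            exact Finset.sum_congr rfl fun i _ => by module)).2
        exact fun i hi => (mul_eq_zero.1 (h' i hi)).resolve_right (by lia)
      refine ⟨ψ (v k) • φ - φ (v k) • ψ, by simp [mul_comm], fun i hi => ?_⟩
      have := hψ i hi
      simp only [map_sub, map_smul, smul_eq_mul, LinearMap.sub_apply, LinearMap.smul_apply] at this ⊢
      linarith
    have hvk : v k ≠ 0 := fun h =>
      one_ne_zero (hv_cons 1 zero_le_one 0 (by simp) (by simp [h])).1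
    obtain ⟨χ, hχ⟩ : ∃ χ : L →ₗ[ℤ] ℤ, 0 < χ (v k) := by
      obtain ⟨χ, hχ⟩ : ∃ χ : L →ₗ[ℤ] ℤ, χ (v k) ≠ 0 := by
        by_contra! h
        exact hvk ((Module.Free.chooseBasis ℤ L).ext_elem fun i => by
          simpa using h ((Module.Free.chooseBasis ℤ L).coord i))
      obtain h | h := hχ.lt_or_gt
      · exact ⟨-χ, by simpa using h⟩
      · exact ⟨χ, h⟩
    refine ⟨(1 + ∑ i ∈ s, |χ (v i)|) • ψ + χ, fun i hi => ?_⟩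
    simp only [LinearMap.add_apply, LinearMap.smul_apply, smul_eq_mul]
    rcases Finset.mem_insert.1 hi with rfl | hi
    · simpa [hψk] using hχ
    · have h1 := Finset.single_le_sum (f := fun i => |χ (v i)|) (fun _ _ => abs_nonneg _) hi
      have h2 := neg_abs_le (χ (v i))
      have h3 := hψ i hi
      have h4 := abs_nonneg (χ (v i))
      nlinarith

theorem WithOne.isCancelMul_of_forall_not_one {M : Type*} [CommSemigroup M]
    (hnoid : ¬ ∃ e : M, ∀ a : M, e * a = a)
    (hcanc : ∀ a b c : M, c * a = c * b → a = b) : IsCancelMul (WithOne M) := by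
  have hne (a b : M) : b * a ≠ b := fun h =>
    hnoid ⟨a, fun c => hcanc _ _ b (by rw [← mul_assoc, h])⟩
  have : IsLeftCancelMul (WithOne M) := ⟨fun c a b h => by
    simp only at h
    cases c with
    | one => simpa using h
    | coe c =>
    cases a with
    | one =>
      cases b with
      | one => rfl
      | coe b =>
        rw [mul_one, ← WithOne.coe_mul, WithOne.coe_inj] at h
        exact absurd h.symm (hne b c)
    | coe a =>
      cases b with
      | one =>
        rw [mul_one, ← WithOne.coe_mul, WithOne.coe_inj] at h
        exact absurd h (hne a c)
      | coe b =>
        rw [← WithOne.coe_mul, ← WithOne.coe_mul, WithOne.coe_inj] at h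
        rw [hcanc _ _ _ h]⟩
  exact CommMagma.IsLeftCancelMul.toIsCancelMul _

theorem WithOne.coe_mul_ne_one {M : Type*} [Mul M] (a : M) (x : WithOne M) :
    (a : WithOne M) * x ≠ 1 := by
  cases x with
  | one => simp
  | coe b => exact WithOne.coe_ne_one

theorem WithOne.coe_spow {M : Type} [Semigroup M] (a : M) (N : ℕ) :
    ((spow a N : M) : WithOne M) = (a : WithOne M) ^ (N + 1) := by
  induction N with
  | zero => simp [spow]
  | succ N ih => rw [spow, WithOne.coe_mul, ih, pow_succ _ (N + 1)]

theorem WithOne.isMulTorsionFree_of_spow {M : Type} [Semigroup M]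
    (hpow : ∀ (a b : M) (N : ℕ), spow a N = spow b N → a = b) :
    IsMulTorsionFree (WithOne M) := by
  refine ⟨fun n hn a b h => ?_⟩
  obtain ⟨N, rfl⟩ := Nat.exists_eq_succ_of_ne_zero hn
  simp only [Nat.succ_eq_add_one] at h
  cases a with
  | one =>
    cases b with
    | one => rfl
    | coe b =>
      rw [one_pow, ← WithOne.coe_spow] at h
      exact absurd h WithOne.one_ne_coe
  | coe a =>
    cases b with
    | one =>
      rw [one_pow, ← WithOne.coe_spow] at h
      exact absurd h WithOne.coe_ne_one
    | coe b =>
      rw [← WithOne.coe_spow, ← WithOne.coe_spow, WithOne.coe_inj] at h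
      rw [hpow _ _ _ h]

theorem WithOne.monoid_fg_of_closure_eq_top {M : Type*} [Semigroup M] (s : Finset M)
    (hs : Subsemigroup.closure (s : Set M) = ⊤) : Monoid.FG (WithOne M) := by
  classical
  refine ⟨s.image (fun a : M => (a : WithOne M)), top_unique fun x _ => ?_⟩
  cases x with
  | one => exact one_mem _
  | coe a =>
    have ha : a ∈ Subsemigroup.closure (s : Set M) := hs ▸ Subsemigroup.mem_top a
    induction ha using Subsemigroup.closure_induction with
    | mem a ha => exact Submonoid.subset_closure (by simpa using ha)
    | mul a b _ _ iha ihb =>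
      rw [WithOne.coe_mul]
      exact mul_mem (iha trivial) (ihb trivial)

/-- A semigroup embedded in a finitely generated free abelian group, with a functional positive on
a finite generating set, embeds into some `ℕ^d`. -/
theorem exists_injective_mulHom_nat_pow {M L : Type*} [Semigroup M] [AddCommGroup L]
    [Module.Free ℤ L] [Module.Finite ℤ L] (s : Finset M)
    (hs : Subsemigroup.closure (s : Set M) = ⊤)
    (j : M → L) (hj : ∀ a b, j (a * b) = j a + j b) (hinj : Function.Injective j)
    (φ : L →ₗ[ℤ] ℤ) (hφ : ∀ a ∈ s, 0 < φ (j a)) :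
    ∃ d : ℕ, 0 < d ∧ ∃ f : M →ₙ* Multiplicative (Fin d → ℕ), Function.Injective f := by
  let B := Module.finBasis ℤ L
  let c (i : Fin (Module.finrank ℤ L)) : ℤ := ∑ a ∈ s, |B.coord i (j a)|
  let F : Fin (Module.finrank ℤ L + 1) → L →ₗ[ℤ] ℤ :=
    Fin.cons φ fun i => c i • φ + B.coord i
  have hgen (k) (a : M) (ha : a ∈ s) : 0 ≤ F k (j a) := by
    induction k using Fin.cases with
    | zero => exact (hφ a ha).le
    | succ i =>
      have h1 : |B.coord i (j a)| ≤ c i :=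
        Finset.single_le_sum (f := fun a => |B.coord i (j a)|) (fun _ _ => abs_nonneg _) ha
      have h2 := neg_abs_le (B.coord i (j a))
      have h3 := hφ a ha
      have h4 := abs_nonneg (B.coord i (j a))
      simp only [F, Fin.cons_succ, LinearMap.add_apply, LinearMap.smul_apply, smul_eq_mul]
      nlinarith
  have hnonneg (k) (a : M) : 0 ≤ F k (j a) := by
    have ha : a ∈ Subsemigroup.closure (s : Set M) := hs ▸ Subsemigroup.mem_top a
    induction ha using Subsemigroup.closure_induction with
    | mem a ha => exact hgen k a ha
    | mul a b _ _ iha ihb => rw [hj, map_add]; exact add_nonneg iha ihb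
  refine ⟨_, Nat.succ_pos _,
    ⟨fun a => Multiplicative.ofAdd fun k => (F k (j a)).toNat, fun a b => ?_⟩, fun a b h => ?_⟩
  · rw [← ofAdd_add]
    congr 1
    funext k
    rw [hj, map_add, Int.toNat_add (hnonneg k a) (hnonneg k b), Pi.add_apply]
  · have hF (k) : F k (j a) = F k (j b) := by
      have := congrFun (Multiplicative.ofAdd.injective h) k
      rw [← Int.toNat_of_nonneg (hnonneg k a), ← Int.toNat_of_nonneg (hnonneg k b)]
      exact congrArg _ this
    refine hinj (B.ext_elem fun i => ?_)
    have h0 : φ (j a) = φ (j b) := hF 0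
    simpa [F, h0] using hF i.succ

/-- A finitely generated, cancellative, power-cancellative commutative semigroup with no
identity element embeds into `(ℕ^d, +)` for some `d > 0`. -/
theorem commSemigroup_embeds_into_nat_pow {M : Type} [CommSemigroup M]
    (hfg : ∃ s : Finset M, Subsemigroup.closure (s : Set M) = ⊤)
    (hnoid : ¬ ∃ e : M, ∀ a : M, e * a = a)
    (hcanc : ∀ a b c : M, c * a = c * b → a = b)
    (hpow : ∀ (a b : M) (N : ℕ), spow a N = spow b N → a = b) :
    ∃ d : ℕ, 0 < d ∧
      ∃ f : M →ₙ* Multiplicative (Fin d → ℕ), Function.Injective f := by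
  classical
  obtain ⟨s, hs⟩ := hfg
  have := WithOne.isCancelMul_of_forall_not_one hnoid hcanc
  have := WithOne.isMulTorsionFree_of_spow hpow
  have := WithOne.monoid_fg_of_closure_eq_top s hs
  let j (a : M) : Additive (Algebra.GrothendieckGroup (WithOne M)) :=
    Additive.ofMul (Algebra.GrothendieckGroup.of (a : WithOne M))
  have hinj : Function.Injective j := fun a b h =>
    WithOne.coe_injective (Algebra.GrothendieckGroup.of_injective (Additive.ofMul.injective h))
  obtain ⟨φ, hφ⟩ := exists_linearMap_int_pos s j fun n hn h a ha => by
    by_contra hna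
    have hprod : ∏ b ∈ s, (b : WithOne M) ^ (n b).toNat = 1 := by
      apply Algebra.GrothendieckGroup.of_injective
      apply Additive.ofMul.injective
      rw [map_prod, map_one, ofMul_one, ofMul_prod, ← h]
      refine Finset.sum_congr rfl fun b hb => ?_
      rw [map_pow, ofMul_pow, ← natCast_zsmul, Int.toNat_of_nonneg (hn b hb)]
    obtain ⟨m, hm⟩ : ∃ m, (n a).toNat = m + 1 :=
      Nat.exists_eq_succ_of_ne_zero (by have := hn a ha; lia)
    rw [← Finset.mul_prod_erase s _ ha, hm, pow_succ', mul_assoc] at hprod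
    exact WithOne.coe_mul_ne_one _ _ hprod
  exact exists_injective_mulHom_nat_pow s hs j
    (fun a b => by simp only [j, WithOne.coe_mul, map_mul, ofMul_mul]) hinj φ hφ
end

section
/- Let S = {1,…,n} and let (S,φ) be a separable, exchangeable interaction. Then (S,φ) is irreducibly quantified if and only if the commutative semigroup M(S,φ) is cancellative and the abelian group G = ℤ^n / ⟨ e_i + e_j − e_k − e_l : ((i,j),(k,l)) ∈ φ ⟩ (where e_1,…,e_n is the standard basis of ℤ^n) is torsion-free. -/
/-- The interaction `(S, φ)` is irreducibly quantified. -/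
def IrreduciblyQuantified {S : Type} [Fintype S] (φ : S × S → S × S → Prop) : Prop :=
  ∀ (X : Type) [Fintype X] (E : X → X → Prop),
    Symmetric E → Irreflexive E → IsConnectedDigraph E →
    ∀ η η' : X → S,
      (∀ ξ : S → ℝ, IsConserved φ ξ → ∑ x, ξ (η x) = ∑ x, ξ (η' x)) →
      Relation.EqvGen (PhiE φ E) η η'

/-- The interaction `(S, φ)` is separable. -/
def SeparableInteraction {S : Type} (φ : S × S → S × S → Prop) : Prop :=
  ∀ s t : S, (∀ ξ : S → ℝ, IsConserved φ ξ → ξ s = ξ t) → s = t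

/-- The subgroup of `ℤ^n` generated by the vectors `e_i + e_j - e_k - e_l` for
`((i,j),(k,l)) ∈ φ`, where `e_1, …, e_n` is the standard basis. -/
def relSubmodule {n : ℕ} (φ : (Fin n × Fin n) → (Fin n × Fin n) → Prop) :
    Submodule ℤ (Fin n → ℤ) :=
  Submodule.span ℤ {v : Fin n → ℤ | ∃ i j k l : Fin n, φ (i, j) (k, l) ∧
    v = Pi.single i 1 + Pi.single j 1 - Pi.single k 1 - Pi.single l 1}

/-! ### Configurations and multisets of states -/

/-- One application of an interaction rule to a multiset of states. -/
def MultisetStep {S : Type} (φ : S × S → S × S → Prop) (A B : Multiset S) : Prop :=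
  ∃ (D : Multiset S) (i j k l : S), φ (i, j) (k, l) ∧
    A = i ::ₘ j ::ₘ D ∧ B = k ::ₘ l ::ₘ D

/-- Two multisets of states are equivalent if they are linked by interaction rules. -/
def MultisetEqv {S : Type} (φ : S × S → S × S → Prop) : Multiset S → Multiset S → Prop :=
  Relation.EqvGen (MultisetStep φ)

/-- The multiset of states of a configuration. -/
def stateMultiset {S X : Type} [Fintype X] (η : X → S) : Multiset S :=
  (Finset.univ : Finset X).val.map η

theorem Relation.EqvGen.lift_of {α β : Type*} {r : α → α → Prop} {p : β → β → Prop}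
    (f : α → β) (h : ∀ a b, r a b → Relation.EqvGen p (f a) (f b)) {a b : α}
    (hab : Relation.EqvGen r a b) : Relation.EqvGen p (f a) (f b) := by
  induction hab with
  | rel x y hxy => exact h x y hxy
  | refl x => exact .refl _
  | symm x y _ ih => exact ih.symm
  | trans x y z _ _ ih₁ ih₂ => exact ih₁.trans _ _ _ ih₂

theorem MultisetEqv.add_left {S : Type} {φ : S × S → S × S → Prop} {A B : Multiset S}
    (h : MultisetEqv φ A B) (D : Multiset S) : MultisetEqv φ (D + A) (D + B) := by
  refine Relation.EqvGen.lift_of (D + ·) ?_ h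
  rintro _ _ ⟨F, i, j, k, l, hφ, rfl, rfl⟩
  exact .rel _ _ ⟨D + F, i, j, k, l, hφ, by simp, by simp⟩

theorem MultisetEqv.add {S : Type} {φ : S × S → S × S → Prop} {A B C D : Multiset S}
    (h : MultisetEqv φ A B) (h' : MultisetEqv φ C D) : MultisetEqv φ (A + C) (B + D) := by
  refine (h'.add_left A).trans _ _ _ ?_
  rw [add_comm A, add_comm B]
  exact h.add_left D

theorem MultisetEqv.card_eq {S : Type} {φ : S × S → S × S → Prop} {A B : Multiset S}
    (h : MultisetEqv φ A B) : A.card = B.card := by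
  induction h with
  | rel _ _ h => obtain ⟨F, i, j, k, l, hφ, rfl, rfl⟩ := h; simp
  | refl => rfl
  | symm _ _ _ ih => exact ih.symm
  | trans _ _ _ _ _ ih₁ ih₂ => exact ih₁.trans ih₂

theorem card_stateMultiset {S X : Type} [Fintype X] (η : X → S) :
    (stateMultiset η).card = Fintype.card X := by
  simp [stateMultiset]

theorem sum_map_stateMultiset {S X : Type} [Fintype X] (η : X → S) (ξ : S → ℝ) :
    ((stateMultiset η).map ξ).sum = ∑ x, ξ (η x) := by
  rw [stateMultiset, Multiset.map_map]
  rfl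

theorem stateMultiset_eq_cons_cons {S X : Type} [Fintype X] [DecidableEq X] {x y : X}
    (hxy : x ≠ y) (η : X → S) :
    stateMultiset η = η x ::ₘ η y ::ₘ ((Finset.univ.erase x).erase y).val.map η := by
  have hy : y ∈ (Finset.univ : Finset X).erase x := by simp [hxy.symm]
  rw [stateMultiset, ← Multiset.map_cons, ← Multiset.map_cons, ← Finset.insert_val_of_notMem
    (Finset.notMem_erase y _), Finset.insert_erase hy, ← Finset.insert_val_of_notMem
    (Finset.notMem_erase x _), Finset.insert_erase (Finset.mem_univ x)]

theorem exists_map_val_eq {S X : Type} [Nonempty S] [DecidableEq X] (s : Finset X) :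
    ∀ D : Multiset S, D.card = s.card → ∃ η : X → S, s.val.map η = D := by
  induction s using Finset.induction_on with
  | empty => intro D hD; exact ⟨fun _ => Classical.arbitrary S, by simp_all⟩
  | insert x s hx ih =>
    intro D hD
    rw [Finset.card_insert_of_notMem hx] at hD
    obtain ⟨a, ha⟩ := (Multiset.card_pos_iff_exists_mem (s := D)).1 (by omega)
    obtain ⟨D, rfl⟩ := Multiset.exists_cons_of_mem ha
    obtain ⟨η, rfl⟩ := ih D (by simpa using hD)
    refine ⟨Function.update η x a, ?_⟩
    rw [Finset.insert_val_of_notMem hx, Multiset.map_cons, Function.update_self]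
    congr 1
    refine Multiset.map_congr rfl fun z hz => Function.update_of_ne ?_ _ _
    rintro rfl
    exact hx hz

theorem exists_stateMultiset_eq {S X : Type} [Fintype X] [Nonempty S] {D : Multiset S}
    (hD : D.card = Fintype.card X) : ∃ η : X → S, stateMultiset η = D := by
  classical
  exact exists_map_val_eq Finset.univ D (by simpa using hD)

theorem exists_perm_of_stateMultiset_eq {S X : Type} [Fintype X] {η η' : X → S}
    (h : stateMultiset η = stateMultiset η') : ∃ σ : Equiv.Perm X, η = η' ∘ σ := by
  classical
  have hfib : ∀ s, Nonempty ({x // η x = s} ≃ {x // η' x = s}) := by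
    intro s
    refine Fintype.card_eq.1 ?_
    have hs := congrArg (Multiset.count s) h
    simp only [stateMultiset, Multiset.count_map] at hs
    simpa only [Fintype.card_subtype, Finset.card_def, Finset.filter_val, eq_comm (b := s)]
      using hs
  exact ⟨Equiv.ofFiberEquiv fun s => (hfib s).some, funext fun x =>
    (Equiv.ofFiberEquiv_map _ x).symm⟩

theorem PhiE.multisetEqv {S X : Type} [Fintype X] {φ : S × S → S × S → Prop}
    {E : X → X → Prop} (hE : ∀ x, ¬E x x) {η η' : X → S} (h : PhiE φ E η η') :
    MultisetEqv φ (stateMultiset η) (stateMultiset η') := by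
  classical
  obtain ⟨x, y, hxy, hφ, hz⟩ := h
  have hne : x ≠ y := by rintro rfl; exact hE x hxy
  refine .rel _ _ ⟨_, _, _, _, _, hφ, stateMultiset_eq_cons_cons hne η, ?_⟩
  rw [stateMultiset_eq_cons_cons hne η']
  congr 2
  refine Multiset.map_congr rfl fun z hz' => ?_
  have hz'' : z ∈ (Finset.univ.erase x).erase y := hz'
  simp only [Finset.mem_erase] at hz''
  exact (hz z hz''.2.1 hz''.1).symm

theorem eqvGen_phiE_update {S X : Type} [DecidableEq X] {φ : S × S → S × S → Prop}
    {E : X → X → Prop} {x y : X} (hxy : E x y) (hne : x ≠ y) (η : X → S) {p q : S × S}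
    (h : Relation.EqvGen φ p q) :
    Relation.EqvGen (PhiE φ E) (Function.update (Function.update η x p.1) y p.2)
      (Function.update (Function.update η x q.1) y q.2) := by
  refine Relation.EqvGen.lift_of
    (fun p : S × S => Function.update (Function.update η x p.1) y p.2) ?_ h
  intro a b hab
  refine .rel _ _ ⟨x, y, hxy, by simpa [hne] using hab, fun z hzx hzy => by simp [hzx, hzy]⟩

theorem eqvGen_phiE_comp_perm {S X : Type} [Fintype X] {φ : S × S → S × S → Prop}
    (hex : Exchangeable φ) {E : X → X → Prop} (hE : ∀ x, ¬E x x)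
    (hconn : IsConnectedDigraph E) (σ : Equiv.Perm X) (η : X → S) :
    Relation.EqvGen (PhiE φ E) η (η ∘ σ) := by
  classical
  let H : Submonoid (Equiv.Perm X) :=
    { carrier := {σ | ∀ η : X → S, Relation.EqvGen (PhiE φ E) η (η ∘ σ)}
      one_mem' := fun η => .refl _
      mul_mem' := fun {a b} ha hb η => (ha η).trans _ _ _ (hb (η ∘ a)) }
  have hedge : ∀ x y, E x y → Equiv.swap x y ∈ H := by
    intro x y hxy η
    have hne : x ≠ y := by rintro rfl; exact hE x hxy
    convert eqvGen_phiE_update hxy hne η (hex (η x) (η y)) using 1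
    · simp
    · funext z
      by_cases hy : z = y
      · subst hy; simp
      · by_cases hx : z = x
        · subst hx; simp [hy]
        · simp [hx, hy, Equiv.swap_apply_of_ne_of_ne]
  have hswap : ∀ x y, Equiv.swap x y ∈ H := by
    intro x y
    induction hconn.2 x y with
    | refl => rw [Equiv.swap_self]; exact H.one_mem
    | tail _ hbc ih => exact SubmonoidClass.swap_mem_trans H ih (hedge _ _ hbc)
  suffices σ ∈ H from this η
  induction σ using Equiv.Perm.swap_induction_on with
  | one => exact H.one_mem
  | swap_mul f x y _ ih => exact H.mul_mem (hswap x y) ih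

theorem eqvGen_phiE_of_stateMultiset_eq {S X : Type} [Fintype X] {φ : S × S → S × S → Prop}
    (hex : Exchangeable φ) {E : X → X → Prop} (hE : ∀ x, ¬E x x)
    (hconn : IsConnectedDigraph E) {η η' : X → S} (h : stateMultiset η = stateMultiset η') :
    Relation.EqvGen (PhiE φ E) η η' := by
  obtain ⟨σ, rfl⟩ := exists_perm_of_stateMultiset_eq h
  exact (eqvGen_phiE_comp_perm hex hE hconn σ η').symm

theorem MultisetEqv.eqvGen_phiE {S X : Type} [Fintype X] {φ : S × S → S × S → Prop}
    (hex : Exchangeable φ) {E : X → X → Prop} (hE : ∀ x, ¬E x x)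
    (hconn : IsConnectedDigraph E) {A B : Multiset S} (h : MultisetEqv φ A B) :
    ∀ η η' : X → S, stateMultiset η = A → stateMultiset η' = B →
      Relation.EqvGen (PhiE φ E) η η' := by
  classical
  induction h with
  | rel _ _ h =>
    obtain ⟨D, i, j, k, l, hφ, rfl, rfl⟩ := h
    intro η η' hη hη'
    have hcard : D.card + 2 = Fintype.card X := by
      rw [← card_stateMultiset η, hη]; simp
    obtain ⟨u, v, huv⟩ := (Fintype.one_lt_card_iff (α := X)).1 (by omega)
    obtain ⟨x, y, hxy⟩ : ∃ x y, E x y := by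
      rcases (Relation.ReflTransGen.cases_head (hconn.2 u v)) with h | ⟨w, hw, _⟩
      · exact absurd h huv
      · exact ⟨u, w, hw⟩
    have hne : x ≠ y := by rintro rfl; exact hE x hxy
    have : Nonempty S := ⟨i⟩
    obtain ⟨ζ, hζ⟩ := exists_map_val_eq ((Finset.univ.erase x).erase y) D (by
      rw [Finset.card_erase_of_mem (by simp [hne.symm]), Finset.card_erase_of_mem (by simp),
        Finset.card_univ]
      omega)
    have hms : ∀ a b, stateMultiset (Function.update (Function.update ζ x a) y b)
        = a ::ₘ b ::ₘ D := by
      intro a b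
      rw [stateMultiset_eq_cons_cons hne, ← hζ]
      congr 1
      · simp [hne]
      · congr 1
        · simp
        · refine Multiset.map_congr rfl fun z hz => ?_
          have hz' : z ∈ (Finset.univ.erase x).erase y := hz
          simp only [Finset.mem_erase] at hz'
          simp [hz'.1, hz'.2.1]
    exact ((eqvGen_phiE_of_stateMultiset_eq hex hE hconn (hη.trans (hms i j).symm)).trans _ _ _
      (eqvGen_phiE_update hxy hne ζ (.rel _ _ hφ))).trans _ _ _
      (eqvGen_phiE_of_stateMultiset_eq hex hE hconn ((hms k l).trans hη'.symm))
  | refl =>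
    intro η η' hη hη'
    exact eqvGen_phiE_of_stateMultiset_eq hex hE hconn (hη.trans hη'.symm)
  | symm _ _ _ ih => exact fun η η' hη hη' => (ih η' η hη' hη).symm
  | trans _ B _ h₁ _ ih₁ ih₂ =>
    intro η η' hη hη'
    have : Nonempty S := ⟨η hconn.1.some⟩
    have hB : B.card = Fintype.card X := by
      rw [← MultisetEqv.card_eq h₁, ← hη, card_stateMultiset]
    obtain ⟨ζ, hζ⟩ := exists_stateMultiset_eq hB
    exact (ih₁ η ζ hη hζ).trans _ _ _ (ih₂ ζ η' hζ hη')

/-! ### Words and multisets of states -/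

/-- The multiset of letters of a word. -/
def letterMultiset {S : Type} (w : FreeSemigroup S) : Multiset S :=
  w.head ::ₘ (w.tail : Multiset S)

theorem letterMultiset_of {S : Type} (i : S) : letterMultiset (FreeSemigroup.of i) = {i} := rfl

theorem letterMultiset_mul {S : Type} (v w : FreeSemigroup S) :
    letterMultiset (v * w) = letterMultiset v + letterMultiset w := by
  rw [letterMultiset, FreeSemigroup.head_mul, FreeSemigroup.tail_mul, ← Multiset.coe_add,
    letterMultiset, letterMultiset, Multiset.cons_add, Multiset.cons_coe]

theorem exists_letterMultiset_eq {S : Type} {A : Multiset S} (hA : A ≠ 0) :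
    ∃ w, letterMultiset w = A := by
  obtain ⟨a, ha⟩ := Multiset.exists_mem_of_ne_zero hA
  obtain ⟨B, rfl⟩ := Multiset.exists_cons_of_mem ha
  exact ⟨⟨a, B.toList⟩, by simp [letterMultiset]⟩

theorem multisetEqv_of_interactionCon {n : ℕ} {φ : (Fin n × Fin n) → (Fin n × Fin n) → Prop}
    {v w : FreeSemigroup (Fin n)} (h : interactionCon φ v w) :
    MultisetEqv φ (letterMultiset v) (letterMultiset w) := by
  have h' : ConGen.Rel (interactionRel φ) v w := h
  induction h' with
  | of _ _ hr =>
    obtain ⟨i, j, k, l, hφ, rfl, rfl⟩ := hr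
    exact .rel _ _ ⟨0, i, j, k, l, hφ, rfl, rfl⟩
  | refl => exact .refl _
  | symm hr ih => exact (ih hr).symm
  | trans h₁ h₂ ih₁ ih₂ => exact (ih₁ h₁).trans _ _ _ (ih₂ h₂)
  | mul h₁ h₂ ih₁ ih₂ =>
    rw [letterMultiset_mul, letterMultiset_mul]
    exact (ih₁ h₁).add (ih₂ h₂)

theorem genM_mul_genM_eq {n : ℕ} {φ : (Fin n × Fin n) → (Fin n × Fin n) → Prop}
    {p q : Fin n × Fin n} (h : Relation.EqvGen φ p q) :
    genM φ p.1 * genM φ p.2 = genM φ q.1 * genM φ q.2 := by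
  induction h with
  | rel p q h =>
    exact (Con.eq _).2 (ConGen.Rel.of _ _ ⟨p.1, p.2, q.1, q.2, h, rfl, rfl⟩)
  | refl => rfl
  | symm _ _ _ ih => exact ih.symm
  | trans _ _ _ _ _ ih₁ ih₂ => exact ih₁.trans ih₂

theorem interactionSemigroup_mul_comm {n : ℕ} {φ : (Fin n × Fin n) → (Fin n × Fin n) → Prop}
    (hex : Exchangeable φ) (a b : InteractionSemigroup φ) : a * b = b * a := by
  induction a using Con.induction_on with | H v =>
  induction b using Con.induction_on with | H w =>
  have hgen : ∀ i, Commute (genM φ i) (w : InteractionSemigroup φ) := by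
    intro i
    induction w using FreeSemigroup.recOnMul with
    | ih1 j => exact genM_mul_genM_eq (hex i j)
    | ih2 j w hj hw => exact Commute.mul_right hj hw
  change Commute _ _
  induction v using FreeSemigroup.recOnMul with
  | ih1 i => exact hgen i
  | ih2 i v hi hv => exact Commute.mul_left hi hv

theorem interactionCon_of_multisetEqv {n : ℕ} {φ : (Fin n × Fin n) → (Fin n × Fin n) → Prop}
    (hex : Exchangeable φ) {v w : FreeSemigroup (Fin n)}
    (h : MultisetEqv φ (letterMultiset v) (letterMultiset w)) : interactionCon φ v w := by
  let _ : CommSemigroup (InteractionSemigroup φ) :=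
    { mul_comm := interactionSemigroup_mul_comm hex }
  let f : Multiset (Fin n) → WithOne (InteractionSemigroup φ) := fun A =>
    (A.map fun i => (genM φ i : WithOne (InteractionSemigroup φ))).prod
  have hf : ∀ A B, MultisetEqv φ A B → f A = f B := by
    intro A B hAB
    induction hAB with
    | rel _ _ h =>
      obtain ⟨D, i, j, k, l, hφ, rfl, rfl⟩ := h
      have := genM_mul_genM_eq (Relation.EqvGen.rel _ _ hφ)
      simp only [f, Multiset.map_cons, Multiset.prod_cons, ← mul_assoc, ← WithOne.coe_mul]
      rw [this]
    | refl => rfl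
    | symm _ _ _ ih => exact ih.symm
    | trans _ _ _ _ _ ih₁ ih₂ => exact ih₁.trans ih₂
  have hword : ∀ u : FreeSemigroup (Fin n),
      f (letterMultiset u) = ((u : InteractionSemigroup φ) : WithOne _) := by
    intro u
    induction u using FreeSemigroup.recOnMul with
    | ih1 i => simp [f, letterMultiset_of, genM]
    | ih2 i u hi hu =>
      rw [letterMultiset_mul, Con.coe_mul, WithOne.coe_mul, ← hi, ← hu]
      simp [f]
  have := hf _ _ h
  rw [hword, hword, WithOne.coe_inj] at this
  exact (Con.eq _).1 this

/-! ### Multisets of states and the abelian group -/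

/-- The vector of multiplicities of a multiset of states. -/
def multisetVec {n : ℕ} : Multiset (Fin n) →+ (Fin n → ℤ) where
  toFun A i := A.count i
  map_zero' := by ext; simp
  map_add' A B := by ext; simp

theorem multisetVec_injective {n : ℕ} : Function.Injective (multisetVec (n := n)) := by
  intro A B h
  ext i
  exact Int.ofNat_inj.1 (congrFun h i)

theorem multisetVec_cons {n : ℕ} (i : Fin n) (A : Multiset (Fin n)) :
    multisetVec (i ::ₘ A) = Pi.single i 1 + multisetVec A := by
  ext j
  by_cases h : j = i
  · subst h; simp [multisetVec, add_comm]
  · simp [multisetVec, h]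

theorem exists_multisetVec_sub_eq {n : ℕ} (v : Fin n → ℤ) :
    ∃ A B : Multiset (Fin n), multisetVec A - multisetVec B = v := by
  have hvec : ∀ f : Fin n → ℕ, ∃ A, multisetVec A = fun i => (f i : ℤ) := fun f =>
    ⟨∑ i, Multiset.replicate (f i) i, by
      ext j
      simp [multisetVec, Multiset.count_replicate]⟩
  obtain ⟨A, hA⟩ := hvec fun i => (v i).toNat
  obtain ⟨B, hB⟩ := hvec fun i => (-v i).toNat
  exact ⟨A, B, by ext i; simp [hA, hB]⟩

theorem MultisetEqv.multisetVec_sub_mem {n : ℕ}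
    {φ : (Fin n × Fin n) → (Fin n × Fin n) → Prop} {A B : Multiset (Fin n)}
    (h : MultisetEqv φ A B) : multisetVec A - multisetVec B ∈ relSubmodule φ := by
  induction h with
  | rel _ _ h =>
    obtain ⟨D, i, j, k, l, hφ, rfl, rfl⟩ := h
    refine Submodule.subset_span ⟨i, j, k, l, hφ, ?_⟩
    simp only [multisetVec_cons]
    abel
  | refl => simp
  | symm _ _ _ ih => rw [← neg_sub]; exact neg_mem ih
  | trans _ _ _ _ _ ih₁ ih₂ => simpa using add_mem ih₁ ih₂

theorem exists_multisetEqv_of_mem_relSubmodule {n : ℕ}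
    {φ : (Fin n × Fin n) → (Fin n × Fin n) → Prop} {v : Fin n → ℤ}
    (hv : v ∈ relSubmodule φ) :
    ∃ A B, MultisetEqv φ A B ∧ multisetVec A - multisetVec B = v := by
  rw [relSubmodule, ← Submodule.mem_toAddSubgroup, Submodule.span_int_eq_addSubgroupClosure] at hv
  induction hv using AddSubgroup.closure_induction with
  | mem v hv =>
    obtain ⟨i, j, k, l, hφ, rfl⟩ := hv
    refine ⟨{i, j}, {k, l}, .rel _ _ ⟨0, i, j, k, l, hφ, rfl, rfl⟩, ?_⟩
    simp only [Multiset.insert_eq_cons, ← Multiset.cons_zero, multisetVec_cons, map_zero]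
    abel
  | zero => exact ⟨0, 0, .refl _, by simp⟩
  | add v w _ _ hv hw =>
    obtain ⟨A, B, h, rfl⟩ := hv
    obtain ⟨C, D, h', rfl⟩ := hw
    exact ⟨A + C, B + D, h.add h', by simp only [map_add]; abel⟩
  | neg v _ hv =>
    obtain ⟨A, B, h, rfl⟩ := hv
    exact ⟨B, A, h.symm, by abel⟩

theorem linearCombination_multisetVec {n : ℕ} (ξ : Fin n → ℝ) (A : Multiset (Fin n)) :
    Fintype.linearCombination ℤ ξ (multisetVec A) = (A.map ξ).sum := by
  induction A using Multiset.induction_on with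
  | empty => simp
  | cons i A ih => simp [multisetVec_cons, ih, Fintype.linearCombination_apply_single]

theorem IsConserved.linearCombination_eq_zero {n : ℕ}
    {φ : (Fin n × Fin n) → (Fin n × Fin n) → Prop} {ξ : Fin n → ℝ} (hξ : IsConserved φ ξ)
    {v : Fin n → ℤ} (hv : v ∈ relSubmodule φ) : Fintype.linearCombination ℤ ξ v = 0 := by
  suffices relSubmodule φ ≤ LinearMap.ker (Fintype.linearCombination ℤ ξ) from this hv
  refine Submodule.span_le.2 ?_
  rintro _ ⟨i, j, k, l, hφ, rfl⟩
  have := hξ i j k l hφ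
  simp only [SetLike.mem_coe, LinearMap.mem_ker, map_sub, map_add,
    Fintype.linearCombination_apply_single, one_smul]
  linarith

theorem mem_relSubmodule_of_forall_isConserved {n : ℕ}
    {φ : (Fin n × Fin n) → (Fin n × Fin n) → Prop}
    (htf : ∀ (g : (Fin n → ℤ) ⧸ relSubmodule φ) (k : ℤ), k ≠ 0 → k • g = 0 → g = 0)
    {v : Fin n → ℤ}
    (hv : ∀ ξ : Fin n → ℝ, IsConserved φ ξ → Fintype.linearCombination ℤ ξ v = 0) :
    v ∈ relSubmodule φ := by
  have : Module.IsTorsionFree ℤ ((Fin n → ℤ) ⧸ relSubmodule φ) :=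
    .of_smul_eq_zero fun k g h => or_iff_not_imp_left.2 fun hk => htf g k hk h
  rw [← Submodule.Quotient.mk_eq_zero, ← Module.forall_dual_apply_eq_zero_iff ℤ]
  intro f
  let g : (Fin n → ℤ) →ₗ[ℤ] ℤ := f ∘ₗ (relSubmodule φ).mkQ
  have hcons : IsConserved φ fun i => ((g (Pi.single i 1) : ℤ) : ℝ) := by
    intro i j k l hφ
    beta_reduce
    have hmem : (Pi.single i 1 + Pi.single j 1 - Pi.single k 1 - Pi.single l 1 : Fin n → ℤ) ∈
        relSubmodule φ := Submodule.subset_span ⟨i, j, k, l, hφ, rfl⟩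
    have h0 : g (Pi.single i 1 + Pi.single j 1 - Pi.single k 1 - Pi.single l 1) = 0 := by
      change f (Submodule.Quotient.mk _) = 0
      rw [(Submodule.Quotient.mk_eq_zero _).2 hmem, map_zero]
    simp only [map_sub, map_add] at h0
    have h1 : g (Pi.single i 1) + g (Pi.single j 1) = g (Pi.single k 1) + g (Pi.single l 1) := by
      linarith
    exact_mod_cast h1
  have hsum := hv _ hcons
  have hg : g v = ∑ i, v i * g (Pi.single i 1) := by
    conv_lhs => rw [← Finset.univ_sum_single v, map_sum]
    refine Finset.sum_congr rfl fun i _ => ?_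
    rw [← smul_eq_mul, ← map_smul, ← Pi.single_smul, smul_eq_mul, mul_one]
  simp only [Fintype.linearCombination_apply, zsmul_eq_mul] at hsum
  change g v = 0
  rw [hg]
  exact_mod_cast hsum

/-! ### The characterization -/

theorem IrreduciblyQuantified.multisetEqv {n : ℕ}
    {φ : (Fin n × Fin n) → (Fin n × Fin n) → Prop} (hiq : IrreduciblyQuantified φ)
    {A B : Multiset (Fin n)}
    (h : ∀ ξ : Fin n → ℝ, IsConserved φ ξ → (A.map ξ).sum = (B.map ξ).sum) :
    MultisetEqv φ A B := by
  have hcard : A.card = B.card := by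
    have := h (fun _ => 1) (fun _ _ _ _ _ => rfl)
    simpa using this
  rcases eq_or_ne A 0 with rfl | hA
  · rw [Multiset.card_zero, eq_comm, Multiset.card_eq_zero] at hcard
    rw [hcard]
    exact .refl _
  have : Nonempty (Fin n) := ⟨(Multiset.exists_mem_of_ne_zero hA).choose⟩
  obtain ⟨m, hm⟩ : ∃ m, A.card = m + 1 :=
    Nat.exists_eq_succ_of_ne_zero (by simpa using hA)
  obtain ⟨η, rfl⟩ := exists_stateMultiset_eq (X := Fin (m + 1)) (D := A) (by simp [hm])
  obtain ⟨η', rfl⟩ := exists_stateMultiset_eq (X := Fin (m + 1)) (D := B)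
    (by simp [← hcard, hm])
  have hirr : ∀ x : Fin (m + 1), ¬x ≠ x := fun _ hx => hx rfl
  refine Relation.EqvGen.lift_of stateMultiset (fun _ _ => PhiE.multisetEqv hirr)
    (hiq (Fin (m + 1)) (fun x y => x ≠ y) (fun _ _ => Ne.symm) hirr ⟨inferInstance, ?_⟩ η η' ?_)
  · intro x y
    rcases eq_or_ne x y with rfl | hxy
    · exact .refl
    · exact .single hxy
  · intro ξ hξ
    simpa only [sum_map_stateMultiset] using h ξ hξ

theorem multisetEqv_of_sub_mem_relSubmodule {n : ℕ}
    {φ : (Fin n × Fin n) → (Fin n × Fin n) → Prop} (hex : Exchangeable φ)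
    (hcancel : ∀ a b c : InteractionSemigroup φ, c * a = c * b → a = b)
    {A B : Multiset (Fin n)} (hA : A ≠ 0) (hB : B ≠ 0)
    (h : multisetVec A - multisetVec B ∈ relSubmodule φ) : MultisetEqv φ A B := by
  obtain ⟨U, V, hUV, hvec⟩ := exists_multisetEqv_of_mem_relSubmodule h
  have heq : V + A = U + B := by
    apply multisetVec_injective
    rw [map_add, map_add]
    linear_combination -hvec
  have hUA : MultisetEqv φ (U + A) (U + B) := heq ▸ hUV.add (.refl A)
  rcases eq_or_ne U 0 with rfl | hU
  · simpa using hUA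
  obtain ⟨a, rfl⟩ := exists_letterMultiset_eq hA
  obtain ⟨b, rfl⟩ := exists_letterMultiset_eq hB
  obtain ⟨u, rfl⟩ := exists_letterMultiset_eq hU
  rw [← letterMultiset_mul, ← letterMultiset_mul] at hUA
  exact multisetEqv_of_interactionCon <| (Con.eq _).1 <|
    hcancel a b u ((Con.eq _).2 (interactionCon_of_multisetEqv hex hUA))

/-- A separable, exchangeable interaction `(S, φ)` is irreducibly quantified if and only
if the commutative semigroup `M(S, φ)` is cancellative and the abelian group
`G = ℤ^n / ⟨e_i + e_j - e_k - e_l : ((i,j),(k,l)) ∈ φ⟩` is torsion-free. -/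
theorem irreduciblyQuantified_iff_cancellative_and_torsionFree {n : ℕ}
    (φ : (Fin n × Fin n) → (Fin n × Fin n) → Prop) (hsymm : Symmetric φ)
    (hsep : SeparableInteraction φ) (hex : Exchangeable φ) :
    IrreduciblyQuantified φ ↔
      ((∀ a b c : InteractionSemigroup φ, c * a = c * b → a = b) ∧
        ∀ (g : (Fin n → ℤ) ⧸ relSubmodule φ) (k : ℤ), k ≠ 0 → k • g = 0 → g = 0) := by
  constructor
  · refine fun hiq => ⟨fun a b c habc => ?_, fun g k hk hg => ?_⟩
    · induction a using Con.induction_on with | H a =>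
      induction b using Con.induction_on with | H b =>
      induction c using Con.induction_on with | H c =>
      have hmem := (multisetEqv_of_interactionCon ((Con.eq _).1 habc)).multisetVec_sub_mem
      rw [letterMultiset_mul, letterMultiset_mul, map_add, map_add, add_sub_add_left_eq_sub]
        at hmem
      refine (Con.eq _).2 (interactionCon_of_multisetEqv hex (hiq.multisetEqv fun ξ hξ => ?_))
      rw [← linearCombination_multisetVec, ← linearCombination_multisetVec, ← sub_eq_zero,
        ← map_sub]
      exact hξ.linearCombination_eq_zero hmem
    · obtain ⟨v, rfl⟩ := Submodule.Quotient.mk_surjective _ g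
      rw [← Submodule.Quotient.mk_smul, Submodule.Quotient.mk_eq_zero] at hg
      obtain ⟨A, B, rfl⟩ := exists_multisetVec_sub_eq v
      refine (Submodule.Quotient.mk_eq_zero _).2
        (hiq.multisetEqv fun ξ hξ => ?_).multisetVec_sub_mem
      rw [← linearCombination_multisetVec, ← linearCombination_multisetVec, ← sub_eq_zero,
        ← map_sub]
      have h0 := hξ.linearCombination_eq_zero hg
      rw [map_smul] at h0
      exact (smul_eq_zero.1 h0).resolve_left hk
  · rintro ⟨hcancel, htf⟩ X _ E _ hE hconn η η' hξ
    have := hconn.1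
    have hne : ∀ ζ : X → Fin n, stateMultiset ζ ≠ 0 := fun ζ h0 =>
      Fintype.card_ne_zero (α := X) (by rw [← card_stateMultiset ζ, h0, Multiset.card_zero])
    refine (multisetEqv_of_sub_mem_relSubmodule hex hcancel (hne η) (hne η') <|
      mem_relSubmodule_of_forall_isConserved htf fun ξ hcons => ?_).eqvGen_phiE hex hE hconn
        η η' rfl rfl
    rw [map_sub, linearCombination_multisetVec, linearCombination_multisetVec, sub_eq_zero]
    simpa only [sum_map_stateMultiset] using hξ ξ hcons
end
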